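/- On a probability space, let X₁, X₂, … be nonnegative random variables with common survival function P(Xᵢ > x) = x^{-α} l(x) for all x > 0, where α > 0 and l is slowly varying at infinity. Let h₁, h₂ > α and suppose Condition A(h₁) and Condition A(h₂) hold. Then log M_{n,h₁}/log M_{n,h₂} − (h₁−α)/(h₂−α) = O_p((log c_n + |log l(t_n)|)/log n); in particular, log M_{n,h₁}/log M_{n,h₂} →p (h₁−α)/(h₂−α) as n → ∞. -/

import Mathlib

open MeasureTheory Filter

noncomputable section

/-- `l` is slowly varying at infinity: for every `lam > 0`, `l(lam*x)/l(x) → 1` as `x → ∞`. -/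
def SlowlyVarying (l : ℝ → ℝ) : Prop :=
  ∀ lam : ℝ, 0 < lam → Tendsto (fun x => l (lam * x) / l x) atTop (nhds 1)

/-- Covariance `Cov(U,V) = E[UV] - E[U]E[V]`. -/
def cov {Ω : Type*} [MeasurableSpace Ω] (μ : Measure Ω) (U V : Ω → ℝ) : ℝ :=
  (∫ ω, U ω * V ω ∂μ) - (∫ ω, U ω ∂μ) * (∫ ω, V ω ∂μ)

/-- Truncation `X·1(X < t)`. -/
def trunc {Ω : Type*} (X : Ω → ℝ) (t : ℝ) : Ω → ℝ :=
  fun ω => if X ω < t then X ω else 0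

/-- Sum of covariances of `p`-th powers of the variables truncated at `v n`,
over distinct pairs of indices among the first `n`. -/
def covSum {Ω : Type*} [MeasurableSpace Ω] (μ : Measure Ω) (X : ℕ → Ω → ℝ)
    (v : ℕ → ℝ) (p : ℝ) (n : ℕ) : ℝ :=
  ∑ i ∈ Finset.range n, ∑ j ∈ Finset.range n,
    if i = j then 0
    else cov μ (fun ω => trunc (X i) (v n) ω ^ p) (fun ω => trunc (X j) (v n) ω ^ p)

/-- Condition A(p). -/
def ConditionA {Ω : Type*} [MeasurableSpace Ω] (μ : Measure Ω) (X : ℕ → Ω → ℝ)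
    (v c : ℕ → ℝ) (p : ℝ) : Prop :=
  Tendsto (fun n => covSum μ X v p n / (v n ^ (2 * p) * c n ^ 2)) atTop (nhds 0)

/-- `p`-th sample moment `M_{n,p}`. -/
def sampleMoment {Ω : Type*} (X : ℕ → Ω → ℝ) (p : ℝ) (n : ℕ) (ω : Ω) : ℝ :=
  (n : ℝ)⁻¹ * ∑ i ∈ Finset.range n, X i ω ^ p

/-- `Y_n = O_p(r_n)`. -/
def IsOp {Ω : Type*} [MeasurableSpace Ω] (μ : Measure Ω) (Y : ℕ → Ω → ℝ) (r : ℕ → ℝ) : Prop :=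
  ∀ ε : ℝ, 0 < ε → ∃ C : ℝ, 0 < C ∧
    ∀ᶠ n in atTop, (μ {ω | C * r n < |Y n ω|}).toReal < ε

/-- Convergence in probability to a constant. -/
def TendstoInProbability {Ω : Type*} [MeasurableSpace Ω] (μ : Measure Ω)
    (Y : ℕ → Ω → ℝ) (a : ℝ) : Prop :=
  ∀ ε : ℝ, 0 < ε → Tendsto (fun n => (μ {ω | ε < |Y n ω - a|}).toReal) atTop (nhds 0)

lemma aux_potter_up (G : ℝ → ℝ) (hG : ∀ x y, 0 < x → x ≤ y → G y ≤ G x) (β x0 : ℝ) (hβ : 0 ≤ β)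
    (hx0 : 0 < x0) (h : ∀ x, x0 ≤ x → G (2 * x) ≤ G x - β * Real.log 2) (x y : ℝ) (hx : x0 ≤ x)
    (hy : x ≤ y) : G y ≤ G x - β * (Real.log y - Real.log x) + β * Real.log 2 := by
  have hxp : 0 < x := by linarith
  have hl2 : 0 < Real.log 2 := Real.log_pos (by norm_num)
  obtain ⟨k, hk1, hk2⟩ := exists_nat_pow_near (x := y / x) (y := 2)
    (by rw [le_div_iff₀ hxp]; linarith) (by norm_num)
  have hind : ∀ k : ℕ, G (2 ^ k * x) ≤ G x - k * (β * Real.log 2) := by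
    intro k
    induction k with
    | zero => simp
    | succ k ih =>
      have h1 : x0 ≤ 2 ^ k * x := by
        have : (1 : ℝ) ≤ 2 ^ k := one_le_pow₀ (by norm_num)
        nlinarith
      have h2 := h _ h1
      have : (2 : ℝ) ^ (k + 1) * x = 2 * (2 ^ k * x) := by ring
      rw [this]; push_cast; linarith
  have h1 : G y ≤ G (2 ^ k * x) := hG _ _ (by positivity) (by rwa [le_div_iff₀ hxp] at hk1)
  have h2 : Real.log y - Real.log x ≤ (k + 1) * Real.log 2 := by
    rw [← Real.log_div (by linarith) (by linarith)]
    have := Real.log_le_log (by apply div_pos <;> linarith) hk2.le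
    rw [Real.log_pow] at this; push_cast at this; exact this
  have h3 := hind k
  nlinarith

lemma aux_potter_lo (G : ℝ → ℝ) (hG : ∀ x y, 0 < x → x ≤ y → G y ≤ G x) (β x0 : ℝ) (hβ : 0 ≤ β)
    (hx0 : 0 < x0) (h : ∀ x, x0 ≤ x → G x - β * Real.log 2 ≤ G (2 * x)) (x y : ℝ) (hx : x0 ≤ x)
    (hy : x ≤ y) : G x - β * (Real.log y - Real.log x) - β * Real.log 2 ≤ G y := by
  have hxp : 0 < x := by linarith
  have hl2 : 0 < Real.log 2 := Real.log_pos (by norm_num)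
  obtain ⟨k, hk1, hk2⟩ := exists_nat_pow_near (x := y / x) (y := 2)
    (by rw [le_div_iff₀ hxp]; linarith) (by norm_num)
  have hind : ∀ k : ℕ, G x - k * (β * Real.log 2) ≤ G (2 ^ k * x) := by
    intro k
    induction k with
    | zero => simp
    | succ k ih =>
      have h1 : x0 ≤ 2 ^ k * x := by
        have : (1 : ℝ) ≤ 2 ^ k := one_le_pow₀ (by norm_num)
        nlinarith
      have h2 := h _ h1
      have : (2 : ℝ) ^ (k + 1) * x = 2 * (2 ^ k * x) := by ring
      rw [this]; push_cast; linarith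
  have h1 : G (2 ^ (k+1) * x) ≤ G y := hG _ _ (by linarith) (by rw [div_lt_iff₀ hxp] at hk2; exact hk2.le)
  have h2 : k * Real.log 2 ≤ Real.log y - Real.log x := by
    rw [← Real.log_div (by linarith) (by linarith)]
    have := Real.log_le_log (by positivity) hk1
    rwa [Real.log_pow] at this
  have h3 := hind (k+1)
  push_cast at h3
  nlinarith

lemma aux_up (G : ℝ → ℝ) (hG : ∀ x y, 0 < x → x ≤ y → G y ≤ G x) (α β : ℝ) (hβ : 0 ≤ β)
    (hd : Tendsto (fun x => G (2 * x) - G x) atTop (nhds (-α * Real.log 2))) (hβα : β < α) :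
    ∃ x0, 0 < x0 ∧ ∀ x y, x0 ≤ x → x ≤ y →
      G y ≤ G x - β * (Real.log y - Real.log x) + β * Real.log 2 := by
  have hl2 : 0 < Real.log 2 := Real.log_pos (by norm_num)
  obtain ⟨x0, h0⟩ := eventually_atTop.1 (hd.eventually_lt_const
    (show -α * Real.log 2 < -β * Real.log 2 by nlinarith))
  refine ⟨max x0 1, by positivity, fun x y hx hy => aux_potter_up G hG β (max x0 1) hβ (by positivity) ?_ x y hx hy⟩
  intro x hx
  have := h0 x (le_trans (le_max_left _ _) hx)
  linarith

lemma aux_lo (G : ℝ → ℝ) (hG : ∀ x y, 0 < x → x ≤ y → G y ≤ G x) (α β : ℝ) (hβ : 0 ≤ β)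
    (hd : Tendsto (fun x => G (2 * x) - G x) atTop (nhds (-α * Real.log 2))) (hβα : α < β) :
    ∃ x0, 0 < x0 ∧ ∀ x y, x0 ≤ x → x ≤ y →
      G x - β * (Real.log y - Real.log x) - β * Real.log 2 ≤ G y := by
  have hl2 : 0 < Real.log 2 := Real.log_pos (by norm_num)
  obtain ⟨x0, h0⟩ := eventually_atTop.1 (hd.eventually_const_lt
    (show -β * Real.log 2 < -α * Real.log 2 by nlinarith))
  refine ⟨max x0 1, by positivity, fun x y hx hy => aux_potter_lo G hG β (max x0 1) hβ (by positivity) ?_ x y hx hy⟩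
  intro x hx
  have := h0 x (le_trans (le_max_left _ _) hx)
  linarith

lemma aux_logratio (G : ℝ → ℝ) (hG : ∀ x y, 0 < x → x ≤ y → G y ≤ G x) (α : ℝ) (hα : 0 < α)
    (hd : Tendsto (fun x => G (2 * x) - G x) atTop (nhds (-α * Real.log 2))) :
    Tendsto (fun x => G x / Real.log x) atTop (nhds (-α)) := by
  have hlt := Real.tendsto_log_atTop
  rw [tendsto_order]
  constructor
  · intro a ha
    obtain ⟨γ, hγ1, hγ2⟩ := exists_between (show α < -a by linarith)
    obtain ⟨x0, hx0, h⟩ := aux_lo G hG α γ (by linarith) hd hγ1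
    filter_upwards [eventually_ge_atTop x0, hlt.eventually_gt_atTop 0,
      hlt.eventually_gt_atTop (-(G x0 + γ * Real.log x0 - γ * Real.log 2) / (-a - γ))] with y hy hy0 hy1
    have := h x0 y le_rfl hy
    rw [div_lt_iff₀ (by linarith)] at hy1
    rw [lt_div_iff₀ hy0]
    nlinarith
  · intro a ha
    obtain ⟨β, hβ1, hβ2⟩ := exists_between (show max 0 (-a) < α by
      apply max_lt <;> linarith)
    have hb0 : 0 < β := lt_of_le_of_lt (le_max_left _ _) hβ1
    have hba : -a < β := lt_of_le_of_lt (le_max_right _ _) hβ1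
    obtain ⟨x0, hx0, h⟩ := aux_up G hG α β hb0.le hd hβ2
    filter_upwards [eventually_ge_atTop x0, hlt.eventually_gt_atTop 0,
      hlt.eventually_gt_atTop ((G x0 + β * Real.log x0 + β * Real.log 2) / (a + β))] with y hy hy0 hy1
    have := h x0 y le_rfl hy
    rw [div_lt_iff₀ (by linarith)] at hy1
    rw [div_lt_iff₀ hy0]
    nlinarith

lemma aux_trunc_nonneg {Ω : Type*} (Y : Ω → ℝ) (hY : ∀ ω, 0 ≤ Y ω) (T p : ℝ) (ω : Ω) :
    0 ≤ trunc Y T ω ^ p := by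
  apply Real.rpow_nonneg
  unfold trunc; split_ifs
  · exact hY ω
  · exact le_rfl

lemma aux_trunc_le {Ω : Type*} (Y : Ω → ℝ) (hY : ∀ ω, 0 ≤ Y ω) (T p : ℝ) (hT : 0 ≤ T) (hp : 0 < p) (ω : Ω) :
    trunc Y T ω ^ p ≤ T ^ p := by
  unfold trunc; split_ifs with h
  · exact Real.rpow_le_rpow (hY ω) h.le hp.le
  · exact Real.rpow_le_rpow le_rfl hT hp.le

lemma aux_trunc_meas {Ω : Type*} [MeasurableSpace Ω] (Y : Ω → ℝ) (hm : Measurable Y) (T p : ℝ) :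
    Measurable fun ω => trunc Y T ω ^ p := by
  have : Measurable (trunc Y T) := by
    unfold trunc
    exact Measurable.ite (measurableSet_lt hm measurable_const) hm measurable_const
  exact this.pow_const p

lemma aux_trunc_memLp {Ω : Type*} [MeasurableSpace Ω] (μ : Measure Ω) [IsProbabilityMeasure μ]
    (Y : Ω → ℝ) (hm : Measurable Y) (hY : ∀ ω, 0 ≤ Y ω) (T p : ℝ) (hT : 0 ≤ T) (hp : 0 < p) (q : ENNReal) :
    MemLp (fun ω => trunc Y T ω ^ p) q μ :=
  memLp_of_bounded (a := 0) (b := T ^ p)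
    (Eventually.of_forall fun ω => ⟨aux_trunc_nonneg Y hY T p ω, aux_trunc_le Y hY T p hT hp ω⟩)
    (aux_trunc_meas Y hm T p).aestronglyMeasurable q

lemma aux_trunc_int {Ω : Type*} [MeasurableSpace Ω] (μ : Measure Ω) [IsProbabilityMeasure μ]
    (Y : Ω → ℝ) (hm : Measurable Y) (hY : ∀ ω, 0 ≤ Y ω) (T p : ℝ) (hT : 0 ≤ T) (hp : 0 < p) :
    Integrable (fun ω => trunc Y T ω ^ p) μ :=
  memLp_one_iff_integrable.1 (aux_trunc_memLp μ Y hm hY T p hT hp 1)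

/-- Upper truncated moment bound. -/
lemma aux_mom_up {Ω : Type*} [MeasurableSpace Ω] (μ : Measure Ω) [IsProbabilityMeasure μ]
    (F : ℝ → ℝ) (hFpos : ∀ x, 0 < x → 0 < F x) (hFanti : ∀ x y, 0 < x → x ≤ y → F y ≤ F x)
    (α p : ℝ) (hα : 0 < α) (hp : α < p)
    (hd : Tendsto (fun x => F (2 * x) / F x) atTop (nhds ((2:ℝ) ^ (-α)))) :
    ∃ C T0 : ℝ, 0 < C ∧ 0 < T0 ∧ ∀ Y : Ω → ℝ, Measurable Y → (∀ ω, 0 ≤ Y ω) →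
      (∀ x, 0 < x → (μ {ω | x < Y ω}).toReal = F x) → ∀ T, T0 ≤ T →
      ∫ ω, trunc Y T ω ^ p ∂μ ≤ C * T ^ p * F T := by
  have hp0 : 0 < p := hα.trans hp
  obtain ⟨β, hβ1, hβ2⟩ := exists_between hp
  have hlt : (2:ℝ) ^ (-β) < (2:ℝ) ^ (-α) := Real.rpow_lt_rpow_of_exponent_lt (by norm_num) (by linarith)
  obtain ⟨x0, h0⟩ := eventually_atTop.1 (hd.eventually_const_lt hlt)
  set d : ℝ := 2 ^ β with hd'
  set P : ℝ := 2 ^ p with hP'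
  have hdpos : 0 < d := by positivity
  have hPpos : 0 < P := by positivity
  have hdP : d < P := Real.rpow_lt_rpow_of_exponent_lt (by norm_num) hβ2
  set x1 := max x0 1 with hx1
  have hx1p : 0 < x1 := by positivity
  have hdbl : ∀ x, x1 ≤ x → F x ≤ d * F (2 * x) := by
    intro x hx
    have h1 := h0 x (le_trans (le_max_left _ _) hx)
    have hxp : 0 < x := by linarith
    rw [Real.rpow_neg (by norm_num), lt_div_iff₀ (hFpos x hxp), ← hd', inv_mul_lt_iff₀ hdpos] at h1
    exact h1.le
  set T0 := 2 * x1 with hT0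
  have hT0p : 0 < T0 := by positivity
  set B := (2 * T0) ^ p / (T0 ^ p * F (2 * T0)) with hB
  have hF2 : 0 < F (2 * T0) := hFpos _ (by positivity)
  set C := max B (P * d ^ 2 / (P - d)) with hC
  have hCpos : 0 < C := lt_of_lt_of_le (by rw [hB]; positivity) (le_max_left _ _)
  refine ⟨C, T0, hCpos, hT0p, ?_⟩
  intro Y hm hY hs
  have hmain : ∀ k : ℕ, ∀ T, T0 ≤ T → T ≤ 2 ^ (k + 1) * T0 → ∫ ω, trunc Y T ω ^ p ∂μ ≤ C * T ^ p * F T := by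
    intro k
    induction k with
    | zero =>
      intro T h1 h2
      have hT : 0 < T := by linarith
      simp only [zero_add, pow_one] at h2
      have e1 : ∫ ω, trunc Y T ω ^ p ∂μ ≤ (2 * T0) ^ p := by
        have : ∫ ω, trunc Y T ω ^ p ∂μ ≤ ∫ ω, (2 * T0) ^ p ∂μ := by
          apply integral_mono (aux_trunc_int μ Y hm hY T p hT.le hp0) (integrable_const _)
          intro ω
          exact (aux_trunc_le Y hY T p hT.le hp0 ω).trans (Real.rpow_le_rpow hT.le h2 hp0.le)
        simpa using this
      have e2 : T0 ^ p * F (2 * T0) ≤ T ^ p * F T := by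
        apply mul_le_mul (Real.rpow_le_rpow hT0p.le h1 hp0.le) (hFanti _ _ hT h2) hF2.le (by positivity)
      calc _ ≤ (2 * T0) ^ p := e1
        _ = B * (T0 ^ p * F (2 * T0)) := by
          rw [hB]; field_simp
        _ ≤ C * (T ^ p * F T) := mul_le_mul (le_max_left _ _) e2 (by positivity) hCpos.le
        _ = _ := by ring
    | succ k ih =>
      intro T h1 h2
      rcases le_total T (2 * T0) with h3 | h3
      · apply ih T h1
        have : (1:ℝ) ≤ 2 ^ k := one_le_pow₀ (by norm_num)
        rw [pow_succ]; nlinarith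
      obtain ⟨S, rfl⟩ : ∃ S, T = 2 * S := ⟨T / 2, by ring⟩
      have hS : T0 ≤ S := by linarith
      have hSp : 0 < S := by linarith
      have hS2 : S ≤ 2 ^ (k + 1) * T0 := by
        rw [pow_succ] at h2; linarith
      have ihS := ih S hS hS2
      have hms : MeasurableSet {ω | S / 2 < Y ω} := measurableSet_lt measurable_const hm
      have e1 : ∫ ω, trunc Y (2 * S) ω ^ p ∂μ ≤ ∫ ω, trunc Y S ω ^ p ∂μ + (2 * S) ^ p * F (S / 2) := by
        have : ∫ ω, trunc Y (2 * S) ω ^ p ∂μ ≤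
            ∫ ω, (trunc Y S ω ^ p + {ω | S / 2 < Y ω}.indicator (fun _ => (2 * S) ^ p) ω) ∂μ := by
          apply integral_mono (aux_trunc_int μ Y hm hY _ p (by positivity) hp0)
            ((aux_trunc_int μ Y hm hY _ p hSp.le hp0).add ((integrable_const _).indicator hms))
          intro ω
          show trunc Y (2 * S) ω ^ p ≤ trunc Y S ω ^ p + {ω | S / 2 < Y ω}.indicator (fun _ => (2 * S) ^ p) ω
          by_cases hc : Y ω < S
          · have : trunc Y (2 * S) ω = trunc Y S ω := by
              unfold trunc; rw [if_pos hc, if_pos (by linarith)]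
            rw [this]
            have : 0 ≤ {ω | S / 2 < Y ω}.indicator (fun _ => (2 * S) ^ p) ω :=
              Set.indicator_nonneg (fun _ _ => by positivity) _
            linarith
          · rw [Set.indicator_of_mem (show ω ∈ {ω | S / 2 < Y ω} by
              simp only [Set.mem_ofPred_eq]; push Not at hc; linarith)]
            have a1 := aux_trunc_le Y hY (2 * S) p (by positivity) hp0 ω
            have a2 := aux_trunc_nonneg Y hY S p ω
            linarith
        rw [integral_add (aux_trunc_int μ Y hm hY _ p hSp.le hp0) ((integrable_const _).indicator hms),
          integral_indicator_const _ hms, measureReal_def, hs _ (by positivity), smul_eq_mul] at this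
        linarith
      have e2 : F (S / 2) ≤ d * F S := by
        have := hdbl (S / 2) (by linarith)
        rwa [show 2 * (S / 2) = S by ring] at this
      have e3 : F S ≤ d * F (2 * S) := hdbl S (by linarith)
      have e4 : (2 * S) ^ p = P * S ^ p := Real.mul_rpow (by norm_num) hSp.le
      have hCP : C * d + P * d ^ 2 ≤ C * P := by
        have : P * d ^ 2 / (P - d) ≤ C := le_max_right _ _
        rw [div_le_iff₀ (by linarith)] at this
        linarith
      have hQ : 0 < S ^ p := by positivity
      have hFS := hFpos S hSp
      have hF2S := hFpos (2 * S) (by positivity)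
      rw [e4] at e1 ⊢
      calc _ ≤ C * S ^ p * F S + P * S ^ p * (d * F S) := by
            refine e1.trans (add_le_add ihS ?_)
            gcongr
        _ = (C + P * d) * S ^ p * F S := by ring
        _ ≤ (C + P * d) * S ^ p * (d * F (2 * S)) := by gcongr
        _ = (C * d + P * d ^ 2) * (S ^ p * F (2 * S)) := by ring
        _ ≤ (C * P) * (S ^ p * F (2 * S)) := by gcongr
        _ = _ := by ring
  intro T hT
  obtain ⟨k, hk⟩ := pow_unbounded_of_one_lt (T / T0) (one_lt_two)
  refine hmain k T hT ?_
  rw [div_lt_iff₀ hT0p] at hk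
  have : (0:ℝ) < 2 ^ k := by positivity
  rw [pow_succ]; nlinarith

/-- Lower truncated moment bound. -/
lemma aux_mom_lo {Ω : Type*} [MeasurableSpace Ω] (μ : Measure Ω) [IsProbabilityMeasure μ]
    (F : ℝ → ℝ) (hFpos : ∀ x, 0 < x → 0 < F x) (hFanti : ∀ x y, 0 < x → x ≤ y → F y ≤ F x)
    (α p : ℝ) (hα : 0 < α) (hp0 : 0 < p)
    (hd : Tendsto (fun x => F (2 * x) / F x) atTop (nhds ((2:ℝ) ^ (-α)))) :
    ∃ C T0 : ℝ, 0 < C ∧ 0 < T0 ∧ ∀ Y : Ω → ℝ, Measurable Y → (∀ ω, 0 ≤ Y ω) →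
      (∀ x, 0 < x → (μ {ω | x < Y ω}).toReal = F x) → ∀ T, T0 ≤ T →
      C * T ^ p * F T ≤ ∫ ω, trunc Y T ω ^ p ∂μ := by
  have hlt : (2:ℝ) ^ (-α) < 1 := by
    have := Real.rpow_lt_rpow_of_exponent_lt (x := 2) (by norm_num) (show -α < 0 by linarith)
    simpa using this
  obtain ⟨q, hq1, hq2⟩ := exists_between hlt
  have hq0 : 0 < q := lt_trans (by positivity) hq1
  obtain ⟨x0, h0⟩ := eventually_atTop.1 (hd.eventually_lt_const hq1)
  set x1 := max x0 1 with hx1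
  have hx1p : 0 < x1 := by positivity
  refine ⟨(1 - q) * (1 / 4) ^ p, 4 * x1, mul_pos (by linarith) (by positivity), by positivity, ?_⟩
  intro Y hm hY hs T hT
  obtain ⟨S, rfl⟩ : ∃ S, T = 4 * S := ⟨T / 4, by ring⟩
  have hS : x1 ≤ S := by linarith
  have hSp : 0 < S := by linarith
  have e1 := h0 S (le_trans (le_max_left _ _) hS)
  rw [div_lt_iff₀ (hFpos S hSp)] at e1
  have e0 : F (4 * S) ≤ F S := hFanti _ _ hSp (by linarith)
  have hms1 : MeasurableSet {ω | S < Y ω} := measurableSet_lt measurable_const hm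
  have hms2 : MeasurableSet {ω | 2 * S < Y ω} := measurableSet_lt measurable_const hm
  have hms := hms1.diff hms2
  have hmeas : μ.real ({ω | S < Y ω} \ {ω | 2 * S < Y ω}) = F S - F (2 * S) := by
    rw [measureReal_sdiff (by intro ω h; simp only [Set.mem_ofPred_eq] at *; linarith) hms2, measureReal_def,
      measureReal_def, hs _ hSp, hs _ (by positivity)]
  have e2 : S ^ p * (F S - F (2 * S)) ≤ ∫ ω, trunc Y (4 * S) ω ^ p ∂μ := by
    have : ∫ ω, ({ω | S < Y ω} \ {ω | 2 * S < Y ω}).indicator (fun _ => S ^ p) ω ∂μ ≤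
        ∫ ω, trunc Y (4 * S) ω ^ p ∂μ := by
      apply integral_mono ((integrable_const _).indicator hms) (aux_trunc_int μ Y hm hY _ p (by positivity) hp0)
      intro ω
      apply Set.indicator_apply_le' 
      · rintro ⟨a, b⟩
        simp only [Set.mem_ofPred_eq] at a b
        have hlt4 : Y ω < 4 * S := by linarith
        show S ^ p ≤ (if Y ω < 4 * S then Y ω else 0) ^ p
        rw [if_pos hlt4]
        exact Real.rpow_le_rpow hSp.le a.le hp0.le
      · intro _; exact aux_trunc_nonneg Y hY _ p ω
    rw [integral_indicator_const _ hms, hmeas, smul_eq_mul] at this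
    linarith
  have e3 : (1 / 4 : ℝ) ^ p * (4 * S) ^ p = S ^ p := by
    rw [← Real.mul_rpow (by norm_num) (by positivity)]; congr 1; ring
  have hQ : 0 < S ^ p := by positivity
  calc _ = (1 - q) * ((1 / 4 : ℝ) ^ p * (4 * S) ^ p) * F (4 * S) := by ring
    _ = S ^ p * ((1 - q) * F (4 * S)) := by rw [e3]; ring
    _ ≤ S ^ p * (F S - F (2 * S)) := by
      gcongr
      nlinarith [hFpos S hSp]
    _ ≤ _ := e2

lemma aux_prob_up {Ω : Type*} [MeasurableSpace Ω] (μ : Measure Ω) [IsProbabilityMeasure μ]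
    (X : ℕ → Ω → ℝ) (hXmeas : ∀ i, Measurable (X i)) (hXnn : ∀ i ω, 0 ≤ X i ω)
    (F : ℝ → ℝ) (hFpos : ∀ x, 0 < x → 0 < F x) (hFanti : ∀ x y, 0 < x → x ≤ y → F y ≤ F x)
    (hs : ∀ i, ∀ x : ℝ, 0 < x → (μ {ω | x < X i ω}).toReal = F x)
    (α p : ℝ) (hα : 0 < α) (hp : α < p)
    (hd : Tendsto (fun x => F (2 * x) / F x) atTop (nhds ((2:ℝ) ^ (-α))))
    (t : ℕ → ℝ) (ht : Tendsto t atTop atTop)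
    (htF : Tendsto (fun n : ℕ => (n : ℝ) * F (t n)) atTop (nhds 0)) :
    Tendsto (fun n : ℕ => μ.real {ω | t n ^ p < ∑ i ∈ Finset.range n, X i ω ^ p}) atTop (nhds 0) := by
  have hp0 : 0 < p := hα.trans hp
  obtain ⟨C, T0, hC, hT0, hmom⟩ := aux_mom_up μ F hFpos hFanti α p hα hp hd
  have hlim : Tendsto (fun n : ℕ => (1 + C * 2 ^ p) * ((n : ℝ) * F (t n))) atTop (nhds 0) := by
    simpa using htF.const_mul (1 + C * 2 ^ p)
  refine tendsto_of_tendsto_of_tendsto_of_le_of_le' tendsto_const_nhds hlim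
    (Eventually.of_forall fun n => measureReal_nonneg) ?_
  filter_upwards [ht.eventually_ge_atTop T0] with n hn
  have htp : 0 < t n := by linarith
  have hQ : 0 < t n ^ p := by positivity
  set S : Ω → ℝ := fun ω => ∑ i ∈ Finset.range n, trunc (X i) (2 * t n) ω ^ p with hS
  have hint : ∀ i ∈ Finset.range n, Integrable (fun ω => trunc (X i) (2 * t n) ω ^ p) μ := fun i _ =>
    aux_trunc_int μ (X i) (hXmeas i) (hXnn i) _ p (by positivity) hp0
  have hsub : {ω | t n ^ p < ∑ i ∈ Finset.range n, X i ω ^ p} ⊆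
      (⋃ i ∈ Finset.range n, {ω | t n < X i ω}) ∪ {ω | t n ^ p ≤ S ω} := by
    intro ω hω
    by_cases hc : ∃ i ∈ Finset.range n, t n < X i ω
    · left
      obtain ⟨i, hi, h⟩ := hc
      simp only [Set.mem_iUnion]
      exact ⟨i, hi, h⟩
    · right
      push Not at hc
      have : S ω = ∑ i ∈ Finset.range n, X i ω ^ p := by
        apply Finset.sum_congr rfl
        intro i hi
        have h1 : X i ω < 2 * t n := by linarith [hc i hi]
        unfold trunc
        rw [if_pos h1]
      show t n ^ p ≤ S ω
      rw [this]; exact le_of_lt hω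
  have h1 : μ.real (⋃ i ∈ Finset.range n, {ω | t n < X i ω}) ≤ n * F (t n) := by
    refine (measureReal_biUnion_finset_le _ _).trans ?_
    rw [Finset.sum_congr rfl (fun i _ => by rw [measureReal_def, hs i _ htp])]
    simp
  have h2 : t n ^ p * μ.real {ω | t n ^ p ≤ S ω} ≤ n * (C * (2 * t n) ^ p * F (2 * t n)) := by
    refine (mul_meas_ge_le_integral_of_nonneg (Eventually.of_forall fun ω =>
      Finset.sum_nonneg fun i _ => aux_trunc_nonneg (X i) (hXnn i) _ p ω) (integrable_finsetSum _ hint) _).trans ?_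
    rw [integral_finsetSum _ hint]
    refine (Finset.sum_le_sum fun i _ => hmom (X i) (hXmeas i) (hXnn i) (hs i) (2 * t n) (by linarith)).trans ?_
    simp
  have h3 : F (2 * t n) ≤ F (t n) := hFanti _ _ htp (by linarith)
  have h4 : μ.real {ω | t n ^ p ≤ S ω} ≤ C * 2 ^ p * (n * F (t n)) := by
    rw [Real.mul_rpow (by norm_num) htp.le] at h2
    have : t n ^ p * μ.real {ω | t n ^ p ≤ S ω} ≤ t n ^ p * (C * 2 ^ p * (n * F (t n))) := by
      calc _ ≤ _ := h2
        _ ≤ n * (C * (2 ^ p * t n ^ p) * F (t n)) := by gcongr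
        _ = _ := by ring
    exact le_of_mul_le_mul_left this hQ
  calc _ ≤ _ := measureReal_mono hsub
    _ ≤ _ := measureReal_union_le _ _
    _ ≤ n * F (t n) + C * 2 ^ p * (n * F (t n)) := add_le_add h1 h4
    _ = _ := by ring

lemma aux_prob_lo {Ω : Type*} [MeasurableSpace Ω] (μ : Measure Ω) [IsProbabilityMeasure μ]
    (X : ℕ → Ω → ℝ) (hXmeas : ∀ i, Measurable (X i)) (hXnn : ∀ i ω, 0 ≤ X i ω)
    (F : ℝ → ℝ) (hFpos : ∀ x, 0 < x → 0 < F x) (hFanti : ∀ x y, 0 < x → x ≤ y → F y ≤ F x)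
    (hs : ∀ i, ∀ x : ℝ, 0 < x → (μ {ω | x < X i ω}).toReal = F x)
    (α p : ℝ) (hα : 0 < α) (hp : α < p)
    (hd : Tendsto (fun x => F (2 * x) / F x) atTop (nhds ((2:ℝ) ^ (-α))))
    (c : ℕ → ℝ) (hc : ∀ n, 0 < c n) (hctop : Tendsto c atTop atTop)
    (v : ℕ → ℝ) (hv : Tendsto v atTop atTop)
    (hvF : Tendsto (fun n : ℕ => (n : ℝ) * F (v n) / c n) atTop (nhds 1))
    (hA : ConditionA μ X v c p) :
    Tendsto (fun n : ℕ => μ.real {ω | ∑ i ∈ Finset.range n, X i ω ^ p < v n ^ p}) atTop (nhds 0) := by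
  have hp0 : 0 < p := hα.trans hp
  obtain ⟨C, T0, hC, hT0, hmom⟩ := aux_mom_up μ F hFpos hFanti α (2 * p) hα (by linarith) hd
  obtain ⟨C1, T1, hC1, hT1, hmom1⟩ := aux_mom_lo μ F hFpos hFanti α p hα hp0 hd
  have hcinv : Tendsto (fun n => (c n)⁻¹) atTop (nhds 0) := tendsto_inv_atTop_zero.comp hctop
  have hlim : Tendsto (fun n : ℕ => (4 / C1) ^ 2 * (C * ((n : ℝ) * F (v n) / c n) * (c n)⁻¹ +
      covSum μ X v p n / (v n ^ (2 * p) * c n ^ 2))) atTop (nhds 0) := by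
    have := (((hvF.const_mul C).mul hcinv).add hA).const_mul ((4 / C1) ^ 2)
    simpa using this
  refine tendsto_of_tendsto_of_tendsto_of_le_of_le' tendsto_const_nhds hlim
    (Eventually.of_forall fun n => measureReal_nonneg) ?_
  filter_upwards [hv.eventually_ge_atTop T0, hv.eventually_ge_atTop T1,
    hvF.eventually_const_lt (show (1/2 : ℝ) < 1 by norm_num),
    hctop.eventually_ge_atTop (4 / C1)] with n hn0 hn1 hnF hnc
  have hvp : 0 < v n := by linarith
  have hcp := hc n
  have hQ : 0 < v n ^ p := by positivity
  set Z : ℕ → Ω → ℝ := fun i ω => trunc (X i) (v n) ω ^ p with hZ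
  have hL : ∀ i ∈ Finset.range n, MemLp (Z i) 2 μ := fun i _ =>
    aux_trunc_memLp μ (X i) (hXmeas i) (hXnn i) _ p hvp.le hp0 2
  have hint : ∀ i ∈ Finset.range n, Integrable (Z i) μ := fun i _ =>
    aux_trunc_int μ (X i) (hXmeas i) (hXnn i) _ p hvp.le hp0
  set S : Ω → ℝ := ∑ i ∈ Finset.range n, Z i with hS
  have hSL : MemLp S 2 μ := memLp_finsetSum' _ hL
  set m := ∫ ω, S ω ∂μ with hm
  have hm1 : C1 * v n ^ p * (n * F (v n)) ≤ m := by
    rw [hm, hS]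
    simp only [Finset.sum_apply]
    rw [integral_finsetSum _ hint]
    refine le_trans ?_ (Finset.sum_le_sum fun i _ => hmom1 (X i) (hXmeas i) (hXnn i) (hs i) (v n) hn1)
    simp; apply le_of_eq; ring
  rw [lt_div_iff₀ hcp] at hnF
  have hm2 : C1 / 2 * v n ^ p * c n ≤ m := by
    have : C1 * v n ^ p * (1/2 * c n) ≤ C1 * v n ^ p * (n * F (v n)) := by gcongr
    linarith
  have hm3 : 2 * v n ^ p ≤ m := by
    rw [div_le_iff₀ hC1] at hnc
    nlinarith
  have hmpos : 0 < m := by linarith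
  have hvar : ProbabilityTheory.variance S μ ≤ n * (C * v n ^ (2 * p) * F (v n)) + covSum μ X v p n := by
    rw [hS, ProbabilityTheory.variance_sum' hL]
    have hsplit : ∀ i ∈ Finset.range n, ∑ j ∈ Finset.range n, ProbabilityTheory.covariance (Z i) (Z j) μ ≤
        C * v n ^ (2 * p) * F (v n) + ∑ j ∈ Finset.range n, (if i = j then 0
          else cov μ (fun ω => trunc (X i) (v n) ω ^ p) (fun ω => trunc (X j) (v n) ω ^ p)) := by
      intro i hi
      have hii : ProbabilityTheory.covariance (Z i) (Z i) μ ≤ C * v n ^ (2 * p) * F (v n) := by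
        rw [ProbabilityTheory.covariance_eq_sub (hL i hi) (hL i hi)]
        have h1 := hmom (X i) (hXmeas i) (hXnn i) (hs i) (v n) hn0
        have h2 : ∫ ω, (Z i * Z i) ω ∂μ = ∫ ω, trunc (X i) (v n) ω ^ (2 * p) ∂μ := by
          congr 1; ext ω
          have h0 : 0 ≤ trunc (X i) (v n) ω := by
            unfold trunc; split_ifs
            · exact hXnn i ω
            · exact le_rfl
          show trunc (X i) (v n) ω ^ p * trunc (X i) (v n) ω ^ p = _
          rw [← Real.rpow_add_of_nonneg h0 hp0.le hp0.le]; congr 1; ring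
        rw [h2]
        nlinarith [mul_self_nonneg (∫ ω, Z i ω ∂μ)]
      rw [← Finset.add_sum_erase _ _ hi, ← Finset.add_sum_erase (a := i) (Finset.range n)
        (fun j => if i = j then 0
          else cov μ (fun ω => trunc (X i) (v n) ω ^ p) (fun ω => trunc (X j) (v n) ω ^ p)) hi]
      simp only [if_true, zero_add]
      refine add_le_add hii (le_of_eq ?_)
      apply Finset.sum_congr rfl
      intro j hj
      have hj' := Finset.mem_erase.1 hj
      rw [if_neg (Ne.symm hj'.1), ProbabilityTheory.covariance_eq_sub (hL i hi) (hL j hj'.2)]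
      rfl
    refine (Finset.sum_le_sum hsplit).trans ?_
    rw [Finset.sum_add_distrib]
    simp [covSum]
  have hsub : {ω | ∑ i ∈ Finset.range n, X i ω ^ p < v n ^ p} ⊆ {ω | m / 2 ≤ |S ω - m|} := by
    intro ω hω
    have hω' : ∑ i ∈ Finset.range n, X i ω ^ p < v n ^ p := hω
    have h1 : S ω ≤ ∑ i ∈ Finset.range n, X i ω ^ p := by
      rw [hS, Finset.sum_apply]
      apply Finset.sum_le_sum
      intro i _
      show trunc (X i) (v n) ω ^ p ≤ _
      unfold trunc; split_ifs
      · exact le_rfl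
      · rw [Real.zero_rpow hp0.ne']; exact Real.rpow_nonneg (hXnn i ω) _
    show m / 2 ≤ |S ω - m|
    rw [abs_sub_comm]
    refine le_trans ?_ (le_abs_self _)
    linarith
  have hcheb : μ.real {ω | m / 2 ≤ |S ω - m|} ≤ ProbabilityTheory.variance S μ / (m / 2) ^ 2 := by
    rw [measureReal_def]
    exact ENNReal.toReal_le_of_le_ofReal
      (div_nonneg (ProbabilityTheory.variance_nonneg _ _) (by positivity))
      (ProbabilityTheory.meas_ge_le_variance_div_sq hSL (by positivity))
  have hvp2 : v n ^ (2 * p) = (v n ^ p) ^ 2 := by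
    rw [mul_comm, Real.rpow_mul hvp.le]; norm_num
  refine (measureReal_mono hsub).trans (hcheb.trans ?_)
  have hden : 0 < C1 / 4 * v n ^ p * c n := by positivity
  calc ProbabilityTheory.variance S μ / (m / 2) ^ 2
      ≤ ProbabilityTheory.variance S μ / (C1 / 4 * v n ^ p * c n) ^ 2 := by
        apply div_le_div_of_nonneg_left (ProbabilityTheory.variance_nonneg _ _) (by positivity)
        apply pow_le_pow_left₀ hden.le
        linarith
    _ ≤ (n * (C * v n ^ (2 * p) * F (v n)) + covSum μ X v p n) / (C1 / 4 * v n ^ p * c n) ^ 2 := by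
        gcongr
    _ = _ := by
        rw [hvp2]; field_simp

lemma aux_to_top (F : ℝ → ℝ) (hFpos : ∀ x, 0 < x → 0 < F x) (hFanti : ∀ x y, 0 < x → x ≤ y → F y ≤ F x)
    (u : ℕ → ℝ) (hu : ∀ n, 0 < u n) (h : Tendsto (fun n => F (u n)) atTop (nhds 0)) :
    Tendsto u atTop atTop := by
  rw [tendsto_atTop]
  intro b
  filter_upwards [h.eventually_lt_const (hFpos (max b 1) (by positivity))] with n hn
  by_contra hcon
  push Not at hcon
  have := hFanti (u n) (max b 1) (hu n) (hcon.le.trans (le_max_left _ _))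
  linarith

lemma aux_ratio (A1 A2 a1 a2 L R : ℝ) (hL : 0 < L) (ha1 : 0 < a1) (ha2 : 0 < a2)
    (h1 : |A1 - a1 * L| ≤ R) (h2 : |A2 - a2 * L| ≤ R) (hR : R ≤ a2 * L / 2) :
    |A1 / A2 - a1 / a2| ≤ 2 * (a1 + a2) / a2 ^ 2 * (R / L) := by
  have hR0 : 0 ≤ R := (abs_nonneg _).trans h1
  have hA2 : a2 * L / 2 ≤ A2 := by
    have := (abs_le.1 h2).1; linarith
  have haL : 0 < a2 * L / 2 := by positivity
  have hA2p : 0 < A2 := by linarith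
  have e : A1 / A2 - a1 / a2 = ((A1 - a1 * L) * a2 - (A2 - a2 * L) * a1) / (A2 * a2) := by
    field_simp; ring
  rw [e, abs_div, abs_of_pos (show 0 < A2 * a2 by positivity)]
  have hnum : |(A1 - a1 * L) * a2 - (A2 - a2 * L) * a1| ≤ (a1 + a2) * R := by
    refine (abs_sub _ _).trans ?_
    rw [abs_mul, abs_mul, abs_of_pos ha1, abs_of_pos ha2]
    nlinarith
  calc _ ≤ (a1 + a2) * R / (a2 * L / 2 * a2) := by
        gcongr
    _ = _ := by field_simp

/-- **Theorem (Taylor's law for higher moments, rate part).**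
For `h₁, h₂ > α`, under Condition A(h₁) and Condition A(h₂),
`log M_{n,h₁}/log M_{n,h₂} − (h₁−α)/(h₂−α) = O_p((log c_n + |log l(t_n)|)/log n)`;
in particular the ratio converges in probability to `(h₁−α)/(h₂−α)`. -/
theorem taylors_law_higher_moments
    {Ω : Type*} [MeasurableSpace Ω] (μ : Measure Ω) [IsProbabilityMeasure μ]
    (X : ℕ → Ω → ℝ) (hXmeas : ∀ i, Measurable (X i)) (hXnn : ∀ i ω, 0 ≤ X i ω)
    (α : ℝ) (hα : 0 < α)
    (l : ℝ → ℝ) (hlpos : ∀ x : ℝ, 0 < x → 0 < l x) (hl : SlowlyVarying l)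
    (hsurv : ∀ i, ∀ x : ℝ, 0 < x → (μ {ω | x < X i ω}).toReal = x ^ (-α) * l x)
    (c : ℕ → ℝ) (hc : ∀ n, 0 < c n) (hctop : Tendsto c atTop atTop)
    (hncmono : Monotone fun n : ℕ => (n : ℝ) * c n)
    (hnctop : Tendsto (fun n : ℕ => (n : ℝ) * c n) atTop atTop)
    (hclog : Tendsto (fun n : ℕ => Real.log (c n) / Real.log n) atTop (nhds 0))
    (t : ℕ → ℝ) (htpos : ∀ n, 0 < t n)
    (ht : Tendsto (fun n : ℕ => (n : ℝ) * c n * l (t n) / t n ^ α) atTop (nhds 1))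
    (v : ℕ → ℝ) (hvpos : ∀ n, 0 < v n)
    (hv : Tendsto (fun n : ℕ => (n : ℝ) * l (v n) / (v n ^ α * c n)) atTop (nhds 1))
    (h₁ h₂ : ℝ) (hh₁ : α < h₁) (hh₂ : α < h₂)
    (hA₁ : ConditionA μ X v c h₁) (hA₂ : ConditionA μ X v c h₂) :
    IsOp μ (fun n ω =>
        Real.log (sampleMoment X h₁ n ω) / Real.log (sampleMoment X h₂ n ω) -
          (h₁ - α) / (h₂ - α))
      (fun n => (Real.log (c n) + |Real.log (l (t n))|) / Real.log n) ∧
    TendstoInProbability μ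
      (fun n ω =>
        Real.log (sampleMoment X h₁ n ω) / Real.log (sampleMoment X h₂ n ω))
      ((h₁ - α) / (h₂ - α)) := by
  set F : ℝ → ℝ := fun x => x ^ (-α) * l x with hF
  have hFpos : ∀ x, 0 < x → 0 < F x := fun x hx => mul_pos (Real.rpow_pos_of_pos hx _) (hlpos x hx)
  have hFanti : ∀ x y, 0 < x → x ≤ y → F y ≤ F x := by
    intro x y hx hxy
    have h1 := hsurv 0 x hx
    have h2 := hsurv 0 y (by linarith)
    show y ^ (-α) * l y ≤ x ^ (-α) * l x
    rw [← h1, ← h2]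
    exact measureReal_mono (μ := μ) (fun ω (h : y < X 0 ω) => lt_of_le_of_lt hxy h)
  have hd : Tendsto (fun x => F (2 * x) / F x) atTop (nhds ((2:ℝ) ^ (-α))) := by
    have h := (hl 2 (by norm_num)).const_mul ((2:ℝ) ^ (-α))
    rw [mul_one] at h
    refine h.congr' ?_
    filter_upwards [eventually_gt_atTop 0] with x hx
    have := hlpos x hx
    have hx' : x ^ (-α) ≠ 0 := (Real.rpow_pos_of_pos hx _).ne'
    simp only [hF]
    rw [Real.mul_rpow (by norm_num) hx.le]
    field_simp
  set G : ℝ → ℝ := fun x => Real.log (F x) with hG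
  have hGanti : ∀ x y, 0 < x → x ≤ y → G y ≤ G x := fun x y hx hxy =>
    Real.log_le_log (hFpos y (by linarith)) (hFanti x y hx hxy)
  have hGd : Tendsto (fun x => G (2 * x) - G x) atTop (nhds (-α * Real.log 2)) := by
    rw [← Real.log_rpow (by norm_num)]
    refine (hd.log (by positivity)).congr' ?_
    filter_upwards [eventually_gt_atTop 0] with x hx
    rw [Real.log_div (hFpos _ (by positivity)).ne' (hFpos x hx).ne']
  have htF : Tendsto (fun n : ℕ => (n : ℝ) * c n * F (t n)) atTop (nhds 1) := by
    refine ht.congr fun n => ?_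
    simp only [hF]
    rw [Real.rpow_neg (htpos n).le]; ring
  have hvF : Tendsto (fun n : ℕ => (n : ℝ) * F (v n) / c n) atTop (nhds 1) := by
    refine hv.congr fun n => ?_
    simp only [hF]
    rw [Real.rpow_neg (hvpos n).le]
    have := hc n
    have : 0 < v n ^ α := Real.rpow_pos_of_pos (hvpos n) _
    field_simp
  have hLtop : Tendsto (fun n : ℕ => Real.log (n : ℝ)) atTop atTop :=
    Real.tendsto_log_atTop.comp tendsto_natCast_atTop_atTop
  have hlctop : Tendsto (fun n : ℕ => Real.log (c n)) atTop atTop :=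
    Real.tendsto_log_atTop.comp hctop
  have hcinv : Tendsto (fun n => (c n)⁻¹) atTop (nhds 0) := tendsto_inv_atTop_zero.comp hctop
  have htF0 : Tendsto (fun n : ℕ => (n : ℝ) * F (t n)) atTop (nhds 0) := by
    have := htF.mul hcinv
    rw [mul_zero] at this
    refine this.congr fun n => ?_
    have := hc n
    field_simp
  have httop : Tendsto t atTop atTop := by
    apply aux_to_top F hFpos hFanti t htpos
    have := htF0.mul (tendsto_inv_atTop_zero.comp (tendsto_natCast_atTop_atTop (R := ℝ)))
    rw [mul_zero] at this
    refine this.congr' ?_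
    filter_upwards [eventually_gt_atTop 0] with n hn
    have : (0:ℝ) < n := by exact_mod_cast hn
    simp only [Function.comp]
    field_simp
  have hcn : Tendsto (fun n : ℕ => c n / n) atTop (nhds 0) := by
    have h1 : Tendsto (fun n : ℕ => Real.log n * (Real.log (c n) / Real.log n - 1)) atTop atBot := by
      apply hLtop.atTop_mul_neg (C := 0 - 1) (by norm_num)
      exact hclog.sub_const 1
    refine (Real.tendsto_exp_atBot.comp h1).congr' ?_
    filter_upwards [eventually_gt_atTop 0, hLtop.eventually_gt_atTop 0] with n hn hLn
    have hn' : (0:ℝ) < n := by exact_mod_cast hn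
    simp only [Function.comp]
    rw [mul_sub, mul_div_cancel₀ _ hLn.ne', mul_one, Real.exp_sub, Real.exp_log (hc n), Real.exp_log hn']
  have hvtop : Tendsto v atTop atTop := by
    apply aux_to_top F hFpos hFanti v hvpos
    have := hvF.mul hcn
    rw [mul_zero] at this
    refine this.congr' ?_
    filter_upwards [eventually_gt_atTop 0] with n hn
    have : (0:ℝ) < n := by exact_mod_cast hn
    have := hc n
    field_simp
  set r : ℕ → ℝ := fun n => Real.log (c n) + |Real.log (l (t n))| with hr
  have hGt : ∀ n, G (t n) = -α * Real.log (t n) + Real.log (l (t n)) := fun n => by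
    simp only [hG, hF]
    rw [Real.log_mul (Real.rpow_pos_of_pos (htpos n) _).ne' (hlpos _ (htpos n)).ne',
      Real.log_rpow (htpos n)]
  have hlt0 : Tendsto (fun n : ℕ => Real.log n + Real.log (c n) + G (t n)) atTop (nhds 0) := by
    have := htF.log one_ne_zero
    rw [Real.log_one] at this
    refine this.congr' ?_
    filter_upwards [eventually_gt_atTop 0] with n hn
    have hn' : (0:ℝ) < n := by exact_mod_cast hn
    rw [Real.log_mul (mul_pos hn' (hc n)).ne' (hFpos _ (htpos n)).ne', Real.log_mul hn'.ne' (hc n).ne']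
  have hlv0 : Tendsto (fun n : ℕ => Real.log n - Real.log (c n) + G (v n)) atTop (nhds 0) := by
    have := hvF.log one_ne_zero
    rw [Real.log_one] at this
    refine this.congr' ?_
    filter_upwards [eventually_gt_atTop 0] with n hn
    have hn' : (0:ℝ) < n := by exact_mod_cast hn
    rw [Real.log_div (mul_pos hn' (hFpos _ (hvpos n))).ne' (hc n).ne',
      Real.log_mul hn'.ne' (hFpos _ (hvpos n)).ne']
    simp only [hG]; ring
  -- r / log n → 0
  have hrL : Tendsto (fun n : ℕ => r n / Real.log n) atTop (nhds 0) := by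
    have h1 : Tendsto (fun n : ℕ => G (t n) / Real.log n) atTop (nhds (-1)) := by
      have a := ((hlt0.div_atTop hLtop).sub hclog).sub_const 1
      have e : (0:ℝ) - 0 - 1 = -1 := by norm_num
      rw [e] at a
      refine a.congr' ?_
      filter_upwards [hLtop.eventually_gt_atTop 0] with n hLn
      field_simp; ring
    have h2 : Tendsto (fun n : ℕ => G (t n) / Real.log (t n)) atTop (nhds (-α)) :=
      (aux_logratio G hGanti α hα hGd).comp httop
    have h3 : Tendsto (fun n : ℕ => Real.log (t n) / Real.log n) atTop (nhds (-1 / -α)) := by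
      refine (h1.div h2 (by linarith)).congr' ?_
      filter_upwards [h1.eventually_lt_const (show (-1:ℝ) < 0 by norm_num),
        (Real.tendsto_log_atTop.comp httop).eventually_gt_atTop 0, hLtop.eventually_gt_atTop 0] with n h hlt hLn
      have hGne : G (t n) ≠ 0 := by
        intro h0; rw [h0] at h; simp at h
      have hlt' : Real.log (t n) ≠ 0 := ne_of_gt hlt
      simp only [Pi.div_apply]
      field_simp
    have h4 : Tendsto (fun n : ℕ => Real.log (l (t n)) / Real.log n) atTop (nhds 0) := by
      have a := h1.add (h3.const_mul α)
      have e : -1 + α * (-1 / -α) = 0 := by field_simp; norm_num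
      rw [e] at a
      refine a.congr fun n => ?_
      rw [hGt n]; ring
    have h5 := hclog.add h4.abs
    rw [abs_zero, add_zero] at h5
    refine h5.congr' ?_
    filter_upwards [hLtop.eventually_gt_atTop 0] with n hLn
    simp only [hr]
    rw [abs_div, abs_of_pos hLn]; ring
  -- deterministic bounds
  obtain ⟨K, hK, hdet⟩ : ∃ K : ℝ, 0 < K ∧ ∀ᶠ n : ℕ in atTop,
      α * Real.log (t n) ≤ Real.log n + K * r n ∧ Real.log n - K * r n ≤ α * Real.log (v n) := by
    obtain ⟨x0, hx0, hup⟩ := aux_up G hGanti α (α / 2) (by positivity) hGd (by linarith)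
    have hl2 : 0 < Real.log 2 := Real.log_pos (by norm_num)
    refine ⟨2 + 2 * (4 + α / 2 * Real.log 2), by positivity, ?_⟩
    filter_upwards [hlt0.eventually_lt_const (show (0:ℝ) < 1 by norm_num),
      hlt0.eventually_const_lt (show (-1:ℝ) < 0 by norm_num),
      hlv0.eventually_lt_const (show (0:ℝ) < 1 by norm_num),
      hlv0.eventually_const_lt (show (-1:ℝ) < 0 by norm_num),
      hlctop.eventually_gt_atTop 1, hvtop.eventually_ge_atTop x0] with n a1 a2 a3 a4 hlc hvx
    have habs := le_abs_self (Real.log (l (t n)))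
    have habs' := neg_abs_le (Real.log (l (t n)))
    have habs0 := abs_nonneg (Real.log (l (t n)))
    have hrn : r n = Real.log (c n) + |Real.log (l (t n))| := rfl
    have hr1 : 1 ≤ r n := by linarith
    have hvt : v n ≤ t n := by
      by_contra hcon
      push Not at hcon
      have := hGanti _ _ (htpos n) hcon.le
      linarith
    have hb := hup _ _ hvx hvt
    have hgt := hGt n
    have hr2 : α / 2 * Real.log 2 ≤ α / 2 * Real.log 2 * r n := by
      have : 0 < α / 2 * Real.log 2 := by positivity
      nlinarith
    have hr3 : 0 ≤ α / 2 * Real.log 2 * r n := by positivity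
    constructor
    · nlinarith
    · nlinarith
  -- good event for one exponent
  have hgood : ∀ p, α < p → ∀ᶠ n : ℕ in atTop, ∀ ω,
      ¬ (t n ^ p < ∑ i ∈ Finset.range n, X i ω ^ p) → ¬ (∑ i ∈ Finset.range n, X i ω ^ p < v n ^ p) →
      |Real.log (sampleMoment X p n ω) - (p - α) / α * Real.log n| ≤ p / α * K * r n := by
    intro p hp
    have hp0 : 0 < p := hα.trans hp
    filter_upwards [hdet, eventually_gt_atTop 0] with n ⟨hd1, hd2⟩ hn ω g1 g2
    push Not at g1 g2
    have hn' : (0:ℝ) < n := by exact_mod_cast hn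
    have hvp : 0 < v n ^ p := Real.rpow_pos_of_pos (hvpos n) _
    have hSp := lt_of_lt_of_le hvp g2
    have l1 := Real.log_le_log hSp g1
    have l2 := Real.log_le_log hvp g2
    rw [Real.log_rpow (htpos n)] at l1
    rw [Real.log_rpow (hvpos n)] at l2
    have hM : Real.log (sampleMoment X p n ω) =
        Real.log (∑ i ∈ Finset.range n, X i ω ^ p) - Real.log n := by
      unfold sampleMoment
      rw [Real.log_mul (by positivity) hSp.ne', Real.log_inv]; ring
    rw [hM]
    have e1 : p * Real.log (t n) ≤ p / α * (Real.log n + K * r n) := by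
      have := mul_le_mul_of_nonneg_left hd1 (show 0 ≤ p / α by positivity)
      have e : p / α * (α * Real.log (t n)) = p * Real.log (t n) := by field_simp
      linarith
    have e2 : p / α * (Real.log n - K * r n) ≤ p * Real.log (v n) := by
      have := mul_le_mul_of_nonneg_left hd2 (show 0 ≤ p / α by positivity)
      have e : p / α * (α * Real.log (v n)) = p * Real.log (v n) := by field_simp
      linarith
    have e3 : (p - α) / α * Real.log n = p / α * Real.log n - Real.log n := by field_simp
    rw [e3, abs_le]
    constructor <;> nlinarith
  set bad : ℝ → ℕ → Set Ω := fun p n => {ω | t n ^ p < ∑ i ∈ Finset.range n, X i ω ^ p} ∪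
    {ω | ∑ i ∈ Finset.range n, X i ω ^ p < v n ^ p} with hbad
  have hbad0 : ∀ p, α < p → ConditionA μ X v c p →
      Tendsto (fun n => μ.real (bad p n)) atTop (nhds 0) := by
    intro p hp hA
    have h1 := aux_prob_up μ X hXmeas hXnn F hFpos hFanti hsurv α p hα hp hd t httop htF0
    have h2 := aux_prob_lo μ X hXmeas hXnn F hFpos hFanti hsurv α p hα hp hd c hc hctop v hvtop hvF hA
    have h3 := h1.add h2
    rw [add_zero] at h3
    exact squeeze_zero (fun n => measureReal_nonneg) (fun n => measureReal_union_le _ _) h3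
  have hB : Tendsto (fun n => μ.real (bad h₁ n ∪ bad h₂ n)) atTop (nhds 0) := by
    have h3 := (hbad0 h₁ hh₁ hA₁).add (hbad0 h₂ hh₂ hA₂)
    rw [add_zero] at h3
    exact squeeze_zero (fun n => measureReal_nonneg) (fun n => measureReal_union_le _ _) h3
  set a1 := (h₁ - α) / α with ha1
  set a2 := (h₂ - α) / α with ha2
  have ha1p : 0 < a1 := div_pos (by linarith) hα
  have ha2p : 0 < a2 := div_pos (by linarith) hα
  have haa : a1 / a2 = (h₁ - α) / (h₂ - α) := by
    have : h₂ - α ≠ 0 := by linarith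
    rw [ha1, ha2]; field_simp
  set K2 := (h₁ + h₂) / α * K with hK2
  have hK2p : 0 < K2 := by
    have : 0 < h₁ + h₂ := by linarith
    positivity
  set C := 2 * (a1 + a2) / a2 ^ 2 * K2 with hC
  have hCp : 0 < C := by positivity
  have hmain : ∀ᶠ n : ℕ in atTop, ∀ ω, ω ∉ bad h₁ n ∪ bad h₂ n →
      |Real.log (sampleMoment X h₁ n ω) / Real.log (sampleMoment X h₂ n ω) -
          (h₁ - α) / (h₂ - α)| ≤ C * (r n / Real.log n) := by
    filter_upwards [hgood h₁ hh₁, hgood h₂ hh₂, hLtop.eventually_gt_atTop 0, hlctop.eventually_gt_atTop 0,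
      hrL.eventually_lt_const (show 0 < a2 / 2 / K2 by positivity)] with n g1 g2 hLn hlc hsm ω hω
    have hrn : 0 ≤ r n := add_nonneg hlc.le (abs_nonneg _)
    simp only [hbad, Set.mem_union, Set.mem_ofPred_eq, not_or] at hω
    obtain ⟨⟨b1, b2⟩, b3, b4⟩ := hω
    have q1 := g1 ω b1 b2
    have q2 := g2 ω b3 b4
    have hKr : 0 ≤ K * r n / α := by positivity
    have k1 : h₁ / α * K * r n ≤ K2 * r n := by
      have : K2 * r n = h₁ / α * K * r n + h₂ * (K * r n / α) := by rw [hK2]; ring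
      nlinarith
    have k2 : h₂ / α * K * r n ≤ K2 * r n := by
      have : K2 * r n = h₂ / α * K * r n + h₁ * (K * r n / α) := by rw [hK2]; ring
      nlinarith
    rw [← haa]
    refine (aux_ratio _ _ a1 a2 (Real.log n) (K2 * r n) hLn ha1p ha2p (q1.trans k1) (q2.trans k2) ?_).trans
      (le_of_eq ?_)
    · rw [div_lt_div_iff₀ hLn hK2p] at hsm
      linarith
    · rw [hC]; ring
  constructor
  · intro ε hε
    refine ⟨C, hCp, ?_⟩
    filter_upwards [hmain, hB.eventually_lt_const hε] with n hn hb
    refine lt_of_le_of_lt ?_ hb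
    refine measureReal_mono (μ := μ) fun ω hω => ?_
    by_contra hcon
    exact absurd (hn ω hcon) (not_le.2 hω)
  · intro ε hε
    refine squeeze_zero' (Eventually.of_forall fun n => ENNReal.toReal_nonneg) ?_ hB
    have hCr := hrL.const_mul C
    rw [mul_zero] at hCr
    filter_upwards [hmain, hCr.eventually_lt_const hε] with n hn hb
    refine measureReal_mono (μ := μ) fun ω hω => ?_
    by_contra hcon
    exact absurd ((hn ω hcon).trans hb.le) (not_le.2 hω)
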